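/- Let p₃ ≥ 4 with gcd(p₃, 3) = 1 and let ν be an integer with gcd(ν, p₃) = 1. Then the pair ((s₁s₂s₁)·s₃^ν·(s₁s₂s₁)⁻¹, s₂) is a generating pair of the triangle group Δ(2, 3, p₃). -/

import Mathlib

/-- Relators of the triangle group Δ(p₁,p₂,p₃) on generators s₁,s₂,s₃. -/
def triangleRels (p₁ p₂ p₃ : ℕ) : Set (FreeGroup (Fin 3)) :=
  {FreeGroup.of 0 ^ p₁, FreeGroup.of 1 ^ p₂, FreeGroup.of 2 ^ p₃,
    FreeGroup.of 0 * FreeGroup.of 1 * FreeGroup.of 2}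

/-- The triangle group Δ(p₁,p₂,p₃). -/
abbrev Triangle (p₁ p₂ p₃ : ℕ) := PresentedGroup (triangleRels p₁ p₂ p₃)

/-- The images s₁, s₂, s₃ of the generators in the triangle group
(indexed by `0, 1, 2 : Fin 3`). -/
def triS (p₁ p₂ p₃ : ℕ) (i : Fin 3) : Triangle p₁ p₂ p₃ := PresentedGroup.of i

/-- A subgroup containing `x ^ k`, with `k` coprime to an exponent `n` of `x`, contains `x`. -/
theorem Subgroup.mem_of_zpow_mem_of_gcd_eq_one {G : Type*} [Group G] (H : Subgroup G) {x : G}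
    {n : ℕ} {k : ℤ} (hx : x ^ n = 1) (hk : Int.gcd k n = 1) (h : x ^ k ∈ H) : x ∈ H := by
  have hbez := Int.gcd_eq_gcd_ab k n
  rw [hk] at hbez
  have hpow : x = (x ^ k) ^ Int.gcdA k n := by
    calc x = x ^ (k * Int.gcdA k n + n * Int.gcdB k n) := by rw [← hbez]; simp
      _ = (x ^ k) ^ Int.gcdA k n := by
        rw [zpow_add, zpow_mul, zpow_mul, zpow_natCast, hx, one_zpow, mul_one]
  rw [hpow]
  exact H.zpow_mem h _

/-- In a group with `a ^ 2 = b ^ 3 = a * b * c = 1`, the conjugate of `c` by `a * b * a`,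
multiplied by `b`, is `c ^ (-3)`. -/
theorem conj_mul_eq_zpow_neg_three {G : Type*} [Group G] {a b c : G} (ha : a ^ 2 = 1)
    (hb : b ^ 3 = 1) (habc : a * b * c = 1) :
    (a * b * a) * c * (a * b * a)⁻¹ * b = c ^ (-3 : ℤ) := by
  have hc : c = (a * b)⁻¹ := eq_inv_of_mul_eq_one_right habc
  have ha' : a⁻¹ = a := inv_eq_of_mul_eq_one_right (by rw [← pow_two, ha])
  have hb' : b⁻¹ * b⁻¹ = b := by
    rw [← mul_inv_rev]
    exact inv_eq_of_mul_eq_one_right (by rw [← hb, pow_three'])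
  calc (a * b * a) * c * (a * b * a)⁻¹ * b
      = a * b * a * (b⁻¹ * (a⁻¹ * a⁻¹) * b⁻¹) * a⁻¹ * b := by rw [hc]; group
    _ = a * b * a * b * a * b := by
      rw [← pow_two a⁻¹, inv_pow, ha, inv_one, mul_one, hb', ha']
    _ = c ^ (-3 : ℤ) := by
      rw [hc, zpow_neg, inv_zpow, inv_inv]
      simp only [zpow_ofNat, pow_succ, pow_zero, one_mul, mul_assoc]

theorem stmt_5 (p₃ : ℕ) (hp₃ : 4 ≤ p₃) (hgcd : Nat.gcd p₃ 3 = 1)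
    (ν : ℤ) (hν : Int.gcd ν p₃ = 1)
    (S : Fin 3 → Triangle 2 3 p₃) (hS : S = triS 2 3 p₃) :
    Subgroup.closure {(S 0 * S 1 * S 0) * S 2 ^ ν * (S 0 * S 1 * S 0)⁻¹, S 1} =
      (⊤ : Subgroup (Triangle 2 3 p₃)) := by
  have rel (r) (hr : r ∈ triangleRels 2 3 p₃) :
      PresentedGroup.mk (triangleRels 2 3 p₃) r = 1 := PresentedGroup.one_of_mem hr
  have h0 : S 0 ^ 2 = 1 := by
    subst hS; exact rel (FreeGroup.of 0 ^ 2) (by simp [triangleRels])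
  have h1 : S 1 ^ 3 = 1 := by
    subst hS; exact rel (FreeGroup.of 1 ^ 3) (by simp [triangleRels])
  have h2 : S 2 ^ p₃ = 1 := by
    subst hS; exact rel (FreeGroup.of 2 ^ p₃) (by simp [triangleRels])
  have h012 : S 0 * S 1 * S 2 = 1 := by
    subst hS
    exact rel (FreeGroup.of 0 * FreeGroup.of 1 * FreeGroup.of 2) (by simp [triangleRels])
  set H := Subgroup.closure {(S 0 * S 1 * S 0) * S 2 ^ ν * (S 0 * S 1 * S 0)⁻¹, S 1}
  have m1 : S 1 ∈ H := Subgroup.subset_closure (by simp)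
  have mconj : (S 0 * S 1 * S 0) * S 2 * (S 0 * S 1 * S 0)⁻¹ ∈ H := by
    refine H.mem_of_zpow_mem_of_gcd_eq_one (n := p₃) ?_ hν ?_
    · rw [conj_pow, h2, mul_one, mul_inv_cancel]
    · rw [conj_zpow]
      exact Subgroup.subset_closure (by simp)
  have m2 : S 2 ∈ H := by
    refine H.mem_of_zpow_mem_of_gcd_eq_one (k := -3) h2 ?_ ?_
    · rw [Int.neg_gcd, Int.gcd_comm]
      exact_mod_cast hgcd
    · rw [← conj_mul_eq_zpow_neg_three h0 h1 h012]
      exact H.mul_mem mconj m1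
  have m0 : S 0 ∈ H := by
    have h : S 0 = (S 2)⁻¹ * (S 1)⁻¹ := by
      rw [← mul_inv_rev]
      exact eq_inv_of_mul_eq_one_left (by rw [← mul_assoc, h012])
    rw [h]
    exact H.mul_mem (H.inv_mem m2) (H.inv_mem m1)
  rw [eq_top_iff, ← PresentedGroup.closure_range_of, Subgroup.closure_le]
  rintro _ ⟨i, rfl⟩
  have hi : PresentedGroup.of i = S i := by rw [hS]; rfl
  rw [hi]
  fin_cases i
  exacts [m0, m1, m2]
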